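/- arXiv:1803.05682 — 2 statements merged into one kernel-verified Lean document; each statement's English description precedes it below -/
import Mathlib

section
/- Suppose (A0)–(A2) hold and the hitting probabilities of (X(t)) are slowly varying along u ∈ E. Then every harmonic function h of the killed chain satisfies h(y ⋆ u) = h(y) + G A_u h (y) for all y ∈ E. -/
open scoped ENNReal Classical BigOperators
open Filter

noncomputable section

namespace RW

variable {G : Type*}

/-- One-step transition operator `Pφ(x) = Σ_y p(x,y) φ(y)`. -/
def kapp (p : G → G → ℝ≥0∞) (φ : G → ℝ≥0∞) (x : G) : ℝ≥0∞ := ∑' y, p x y * φ y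

/-- n-step transition kernel. -/
def kiter (p : G → G → ℝ≥0∞) : ℕ → G → G → ℝ≥0∞
  | 0 => fun x y => if x = y then 1 else 0
  | n + 1 => fun x y => ∑' z, p x z * kiter p n z y

/-- Green function `G(x,y) = Σ_t ℙ_x(X(t)=y)`. -/
def green (p : G → G → ℝ≥0∞) (x y : G) : ℝ≥0∞ := ∑' n, kiter p n x y

/-- Green operator `Gφ(x) = Σ_y G(x,y) φ(y)`. -/
def greenApp (p : G → G → ℝ≥0∞) (φ : G → ℝ≥0∞) (x : G) : ℝ≥0∞ := ∑' y, green p x y * φ y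

/-- Probability of first hitting `y` at time `n ≥ 1`. -/
def fhit (p : G → G → ℝ≥0∞) : ℕ → G → G → ℝ≥0∞
  | 0 => fun _ _ => 0
  | 1 => p
  | n + 2 => fun x y => ∑' z, if z = y then 0 else p x z * fhit p (n + 1) z y

/-- Hitting probability `Q(x,y) = ℙ_x(∃ t ≥ 1, X(t) = y)`. -/
def hitProb (p : G → G → ℝ≥0∞) (x y : G) : ℝ≥0∞ := ∑' n, fhit p n x y

/-- Survival probability `ℙ_x(τ_ϑ > n)`. -/
def surv (p : G → G → ℝ≥0∞) (n : ℕ) (x : G) : ℝ≥0∞ := ∑' y, kiter p n x y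

/-- Expected lifetime `𝔼_x(τ_ϑ) = Σ_n ℙ_x(τ_ϑ > n)`. -/
def gexp (p : G → G → ℝ≥0∞) (x : G) : ℝ≥0∞ := ∑' n, surv p n x

variable [Group G]

/-- Matrix coefficients `a_u(x,y)` of the operator `A_u = T_u P - P T_u`. -/
def acoef (p : G → G → ℝ≥0∞) (E : Set G) (u x y : G) : ℝ≥0∞ :=
  if y * u⁻¹ ∈ E then p (x * u) y - p x (y * u⁻¹) else p (x * u) y

/-- The operator `A_u φ(x) = Σ_y a_u(x,y) φ(y)`. -/
def Aop (p : G → G → ℝ≥0∞) (E : Set G) (u : G) (φ : G → ℝ≥0∞) (x : G) : ℝ≥0∞ :=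
  ∑' y, acoef p E u x y * φ y

/-- Ladder height transition kernel `p_H(x,y) = G A_x 𝟙_{y}(e)`. -/
def ladder (p : G → G → ℝ≥0∞) (E : Set G) (x y : G) : ℝ≥0∞ :=
  ∑' z, green p 1 z * acoef p E x z y

/-- The renewal function `V(x) = 𝔼_x(𝒯_ϑ)` of the ladder height process. -/
def V (p : G → G → ℝ≥0∞) (E : Set G) (x : G) : ℝ≥0∞ :=
  ∑' n, surv (ladder p E) n x

end RW

end

open RW

namespace RW

section Kernel

variable {G : Type*} {p : G → G → ℝ≥0∞} {E : Set G}

lemma kapp_add (f g : G → ℝ≥0∞) : kapp p (f + g) = kapp p f + kapp p g := by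
  funext x
  simp only [kapp, Pi.add_apply, mul_add]
  exact ENNReal.tsum_add

lemma kapp_const_mul (c : ℝ≥0∞) (f : G → ℝ≥0∞) :
    kapp p (fun x => c * f x) = fun x => c * kapp p f x := by
  funext x
  simp only [kapp, ← ENNReal.tsum_mul_left]
  exact tsum_congr fun y => by ring

lemma kapp_mono : Monotone (kapp p) := fun f g hfg x =>
  ENNReal.tsum_le_tsum fun y => by gcongr; exact hfg y

lemma kapp_iterate_mono (k : ℕ) : Monotone (kapp p)^[k] := kapp_mono.iterate k

lemma kapp_iterate_add (k : ℕ) (f g : G → ℝ≥0∞) :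
    (kapp p)^[k] (f + g) = (kapp p)^[k] f + (kapp p)^[k] g := by
  induction k generalizing f g with
  | zero => rfl
  | succ k ih => simp only [Function.iterate_succ_apply, kapp_add, ih]

lemma kapp_iterate_const_mul (k : ℕ) (c : ℝ≥0∞) (f : G → ℝ≥0∞) :
    (kapp p)^[k] (fun x => c * f x) = fun x => c * (kapp p)^[k] f x := by
  induction k generalizing f with
  | zero => rfl
  | succ k ih => simp only [Function.iterate_succ_apply, kapp_const_mul, ih]

lemma tsum_kiter_mul (n : ℕ) (φ : G → ℝ≥0∞) (x : G) :
    ∑' y, kiter p n x y * φ y = (kapp p)^[n] φ x := by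
  induction n generalizing x with
  | zero =>
    rw [tsum_eq_single x]
    · simp [kiter]
    · intro y hy
      simp [kiter, hy.symm]
  | succ n ih =>
    simp only [Function.iterate_succ_apply', kapp, kiter, ← ih, ← ENNReal.tsum_mul_left,
      ← ENNReal.tsum_mul_right]
    rw [ENNReal.tsum_comm]
    simp only [mul_assoc]

lemma greenApp_eq_tsum_iterate (φ : G → ℝ≥0∞) (x : G) :
    greenApp p φ x = ∑' n, (kapp p)^[n] φ x := by
  simp only [greenApp, green, ← tsum_kiter_mul, ← ENNReal.tsum_mul_right]
  exact ENNReal.tsum_comm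

lemma kapp_greenApp_add (φ : G → ℝ≥0∞) : φ + kapp p (greenApp p φ) = greenApp p φ := by
  funext x
  simp only [Pi.add_apply, kapp, greenApp_eq_tsum_iterate, ← ENNReal.tsum_mul_left]
  rw [ENNReal.tsum_comm, tsum_eq_zero_add' (f := fun n => (kapp p)^[n] φ x) ENNReal.summable]
  simp only [Function.iterate_succ_apply']
  rfl

/-- Finite nonnegative superharmonic functions. -/
def IsSuper (p : G → G → ℝ≥0∞) (w : G → ℝ≥0∞) : Prop := (∀ x, w x ≠ ⊤) ∧ kapp p w ≤ w

/-- Finite nonnegative harmonic functions. -/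
def IsHarm (p : G → G → ℝ≥0∞) (w : G → ℝ≥0∞) : Prop := (∀ x, w x ≠ ⊤) ∧ kapp p w = w

/-- The limit of `Pᵏ w`, which is the harmonic part of a superharmonic function `w`. -/
noncomputable def harmPart (p : G → G → ℝ≥0∞) (w : G → ℝ≥0∞) (x : G) : ℝ≥0∞ :=
  ⨅ k, (kapp p)^[k] w x

variable {w w₁ w₂ f : G → ℝ≥0∞}

lemma IsHarm.isSuper (hf : IsHarm p f) : IsSuper p f := ⟨hf.1, hf.2.le⟩

lemma IsHarm.const_mul (hf : IsHarm p f) {c : ℝ≥0∞} (hc : c ≠ ⊤) :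
    IsHarm p (fun x => c * f x) :=
  ⟨fun x => ENNReal.mul_ne_top hc (hf.1 x), by rw [kapp_const_mul, hf.2]⟩

lemma IsHarm.of_add_eq {g : G → ℝ≥0∞} (hf : IsHarm p f) (hg : IsHarm p g) (h : w + g = f) :
    IsHarm p w := by
  refine ⟨fun x hx => hf.1 x (by simp [← h, hx]), ?_⟩
  have h1 : kapp p w + g = w + g := by
    conv_lhs => rw [← hg.2]
    rw [← kapp_add, h, hf.2]
  funext x
  exact (ENNReal.add_left_inj (hg.1 x)).1 (congrFun h1 x)

lemma IsSuper.antitone (hw : IsSuper p w) (x : G) : Antitone fun k => (kapp p)^[k] w x :=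
  antitone_nat_of_succ_le fun k => by
    rw [Function.iterate_succ_apply]
    exact kapp_iterate_mono k hw.2 x

lemma IsSuper.tendsto (hw : IsSuper p w) (x : G) :
    Tendsto (fun k => (kapp p)^[k] w x) atTop (nhds (harmPart p w x)) :=
  tendsto_atTop_iInf (hw.antitone x)

lemma harmPart_le (w : G → ℝ≥0∞) : harmPart p w ≤ w := fun _ => iInf_le _ 0

lemma harmPart_mono : Monotone (harmPart p) := fun _ _ h x =>
  iInf_mono fun k => kapp_iterate_mono k h x

lemma IsHarm.harmPart_eq (hf : IsHarm p f) : harmPart p f = f := by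
  funext x
  simp [harmPart, Function.iterate_fixed hf.2]

lemma IsSuper.harmPart_add (h₁ : IsSuper p w₁) (h₂ : IsSuper p w₂) :
    harmPart p (w₁ + w₂) = harmPart p w₁ + harmPart p w₂ := by
  have h : IsSuper p (w₁ + w₂) :=
    ⟨fun x => ENNReal.add_ne_top.2 ⟨h₁.1 x, h₂.1 x⟩, by
      rw [kapp_add]; exact add_le_add h₁.2 h₂.2⟩
  funext x
  refine tendsto_nhds_unique (h.tendsto x) ?_
  simp only [kapp_iterate_add]
  exact (h₁.tendsto x).add (h₂.tendsto x)

lemma harmPart_const_mul {c : ℝ≥0∞} (hc : c ≠ ⊤) :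
    harmPart p (fun x => c * w x) = fun x => c * harmPart p w x := by
  funext x
  simp only [harmPart, kapp_iterate_const_mul]
  rw [ENNReal.mul_iInf (fun h => absurd h hc)]

/-- The Riesz decomposition. -/
lemma IsSuper.riesz (hw : IsSuper p w) {φ : G → ℝ≥0∞} (hφ : φ + kapp p w = w) :
    harmPart p w + greenApp p φ = w := by
  have key (n : ℕ) : (kapp p)^[n] w + ∑ k ∈ Finset.range n, (kapp p)^[k] φ = w := by
    induction n with
    | zero => simp
    | succ n ih =>
      conv_rhs => rw [← ih]
      conv_rhs => rw [← hφ]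
      rw [Finset.sum_range_succ, kapp_iterate_add, ← Function.iterate_succ_apply]
      abel
  funext x
  refine tendsto_nhds_unique ?_ (tendsto_const_nhds (f := (atTop : Filter ℕ)))
  have h1 := (hw.tendsto x).add
    (ENNReal.summable (f := fun n => (kapp p)^[n] φ x)).hasSum.tendsto_sum_nat
  rw [← greenApp_eq_tsum_iterate] at h1
  refine h1.congr fun n => ?_
  conv_rhs => rw [← key n]
  simp

lemma IsSuper.exists_charge (hw : IsSuper p w) : ∃ φ : G → ℝ≥0∞, φ + kapp p w = w :=
  ⟨w - kapp p w, by funext x; exact tsub_add_cancel_of_le (hw.2 x)⟩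

lemma IsSuper.isHarm_harmPart (hw : IsSuper p w) : IsHarm p (harmPart p w) := by
  obtain ⟨φ, hφ⟩ := hw.exists_charge
  have hR := hw.riesz hφ
  refine ⟨fun x hx => hw.1 x (top_le_iff.1 (hx ▸ harmPart_le w x)), ?_⟩
  have h1 : kapp p (harmPart p w) + greenApp p φ = harmPart p w + greenApp p φ := by
    conv_lhs => rw [← kapp_greenApp_add]
    rw [add_left_comm, ← kapp_add, hR, hφ]
  funext x
  refine (ENNReal.add_left_inj ?_).1 (congrFun h1 x)
  intro hx
  exact hw.1 x (by rw [← hR]; simp [hx])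

lemma IsSuper.greenApp_of_charge (hw : IsSuper p w) {φ : G → ℝ≥0∞} (hφ : φ + kapp p w = w) :
    IsSuper p (greenApp p φ) := by
  refine ⟨fun x hx => hw.1 x ?_, ?_⟩
  · rw [← hw.riesz hφ]; simp [hx]
  · conv_rhs => rw [← kapp_greenApp_add]
    exact le_add_self

lemma IsSuper.harmPart_greenApp (hw : IsSuper p w) {φ : G → ℝ≥0∞} (hφ : φ + kapp p w = w) :
    harmPart p (greenApp p φ) = 0 := by
  have hH := hw.isHarm_harmPart
  have h1 := hH.isSuper.harmPart_add (hw.greenApp_of_charge hφ)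
  rw [hw.riesz hφ, hH.harmPart_eq] at h1
  funext x
  refine (ENNReal.add_right_inj (hH.1 x)).1 ?_
  simpa using (congrFun h1 x).symm

lemma sum_fhit_mul_le (hf : kapp p f ≤ f) (y : G) (n : ℕ) (x : G) :
    (∑ k ∈ Finset.range n, fhit p (k + 1) x y) * f y ≤ f x := by
  induction n generalizing x with
  | zero => simp
  | succ n ih =>
    refine le_trans ?_ (hf x)
    have h1 : ∑ k ∈ Finset.range n, fhit p (k + 1 + 1) x y
        = ∑' z, if z = y then 0 else p x z * ∑ k ∈ Finset.range n, fhit p (k + 1) z y := by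
      simp only [fhit]
      rw [← Summable.tsum_finsetSum fun _ _ => ENNReal.summable]
      refine tsum_congr fun z => ?_
      split_ifs <;> simp [Finset.mul_sum]
    rw [Finset.sum_range_succ', h1]
    simp only [fhit]
    rw [kapp, ENNReal.tsum_eq_add_tsum_ite (f := fun z => p x z * f z) y, add_mul,
      add_comm, ← ENNReal.tsum_mul_right]
    gcongr with z
    split_ifs
    · simp
    · rw [mul_assoc]
      gcongr
      exact ih z

lemma hitProb_mul_le (hf : kapp p f ≤ f) (x y : G) : hitProb p x y * f y ≤ f x := by
  have h0 : hitProb p x y = ∑' n, fhit p (n + 1) x y := by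
    rw [hitProb, tsum_eq_zero_add' ENNReal.summable]
    simp [fhit]
  rw [h0, ENNReal.tsum_eq_iSup_nat, ENNReal.iSup_mul]
  exact iSup_le fun n => sum_fhit_mul_le hf y n x

lemma hitProb_le_one (hsub : ∀ x, (∑' y, p x y) ≤ 1) (x y : G) : hitProb p x y ≤ 1 := by
  have := hitProb_mul_le (p := p) (f := fun _ => 1) (fun x => by simpa [kapp] using hsub x) x y
  simpa using this

lemma kapp_eq_zero_of_notMem (hsupp : ∀ x y, p x y ≠ 0 → x ∈ E ∧ y ∈ E) {x : G} (hx : x ∉ E)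
    (f : G → ℝ≥0∞) : kapp p f x = 0 := by
  refine ENNReal.tsum_eq_zero.2 fun y => ?_
  have : p x y = 0 := by
    by_contra h
    exact hx (hsupp x y h).1
  simp [this]

lemma kapp_congr (hsupp : ∀ x y, p x y ≠ 0 → x ∈ E ∧ y ∈ E) {f g : G → ℝ≥0∞}
    (hfg : Set.EqOn f g E) : kapp p f = kapp p g := by
  funext x
  refine tsum_congr fun y => ?_
  by_cases hy : p x y = 0
  · simp [hy]
  · rw [hfg (hsupp x y hy).2]

lemma exists_isHarm_sub {g : G → ℝ≥0∞} (hf : IsHarm p f) (hg : IsHarm p g) (c : ℝ)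
    (hle : ∀ x, g x ≤ ENNReal.ofReal c * f x) :
    ∃ d, IsHarm p d ∧ d + g = fun x => ENNReal.ofReal c * f x := by
  have h : (fun x => ENNReal.ofReal c * f x - g x) + g = fun x => ENNReal.ofReal c * f x := by
    funext x; exact tsub_add_cancel_of_le (hle x)
  exact ⟨_, (hf.const_mul ENNReal.ofReal_ne_top).of_add_eq hg h, h⟩

lemma greenApp_eqOn (hsupp : ∀ x y, p x y ≠ 0 → x ∈ E ∧ y ∈ E) {f g : G → ℝ≥0∞}
    (hfg : Set.EqOn f g E) : Set.EqOn (greenApp p f) (greenApp p g) E := by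
  intro x hx
  simp only [greenApp_eq_tsum_iterate]
  refine tsum_congr fun n => ?_
  cases n with
  | zero => exact hfg hx
  | succ n => rw [Function.iterate_succ_apply, Function.iterate_succ_apply, kapp_congr hsupp hfg]

end Kernel

section SquareRoot

variable {α : Type*} {K : Set (α → ℝ≥0∞)} {T : (α → ℝ≥0∞) → α → ℝ≥0∞}

/-- A positive operator on a cone of functions which is bounded by a multiple of the identity
is bounded by `r` as soon as its square is bounded by `r²`. -/
lemma le_of_sq_le (hfin : ∀ f ∈ K, ∀ x, f x ≠ ⊤) (hT : ∀ f ∈ K, T f ∈ K)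
    (hsmul : ∀ f ∈ K, ∀ c : ℝ, T (fun x => ENNReal.ofReal c * f x)
      = fun x => ENNReal.ofReal c * T f x)
    (hadd : ∀ f ∈ K, ∀ g ∈ K, T (f + g) = T f + T g)
    (hdiff : ∀ f ∈ K, ∀ g ∈ K, ∀ c : ℝ, (∀ x, g x ≤ ENNReal.ofReal c * f x) →
      ∃ d ∈ K, d + g = fun x => ENNReal.ofReal c * f x)
    {C r : ℝ} (hC : ∀ f ∈ K, ∀ x, T f x ≤ ENNReal.ofReal C * f x) (hr : 0 < r)
    (hsq : ∀ f ∈ K, ∀ x, T (T f) x ≤ ENNReal.ofReal (r ^ 2) * f x) :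
    ∀ f ∈ K, ∀ x, T f x ≤ ENNReal.ofReal r * f x := by
  set A : Set ℝ := {c | 0 ≤ c ∧ ∀ f ∈ K, ∀ x, T f x ≤ ENNReal.ofReal c * f x} with hA
  have hAne : A.Nonempty := ⟨max C 0, le_max_right _ _, fun f hf x => (hC f hf x).trans (by
    gcongr; exact le_max_left _ _)⟩
  have hAbdd : BddBelow A := ⟨0, fun c hc => hc.1⟩
  have hAcl : IsClosed A := by
    rw [hA, Set.ofPred_and]
    refine isClosed_Ici.inter ?_
    simp only [Set.ofPred_forall]
    refine isClosed_iInter fun f => isClosed_iInter fun hf => isClosed_iInter fun x => ?_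
    refine isClosed_le continuous_const ?_
    exact (ENNReal.continuous_mul_const (hfin f hf x)).comp ENNReal.continuous_ofReal
  set l := sInf A
  have hl : l ∈ A := hAcl.csInf_mem hAne hAbdd
  suffices l ≤ r from fun f hf x => (hl.2 f hf x).trans (by gcongr)
  rcases hl.1.eq_or_lt with h0 | hpos
  · rw [← h0]; exact hr.le
  have hmem : (l ^ 2 + r ^ 2) / (2 * l) ∈ A := by
    refine ⟨by positivity, fun f hf x => ?_⟩
    obtain ⟨d, hd, hde⟩ := hdiff f hf (T f) (hT f hf) l (hl.2 f hf)
    have h1 := congrFun (hadd d hd (T f) (hT f hf)) x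
    rw [hde, hsmul f hf] at h1
    have h2 := hl.2 d hd x
    have h3 := hsq f hf x
    have h4 := congrFun hde x
    simp only [Pi.add_apply] at h1 h4
    have e1 := hfin _ hf x
    have e2 := hfin _ (hT _ hf) x
    have e3 := hfin _ (hT _ (hT _ hf)) x
    have e4 := hfin _ hd x
    have e5 := hfin _ (hT _ hd) x
    lift f x to NNReal using e1 with a
    lift T f x to NNReal using e2 with b
    lift T (T f) x to NNReal using e3 with c
    lift d x to NNReal using e4 with s
    lift T d x to NNReal using e5 with t
    simp only [ENNReal.ofReal] at *
    norm_cast at *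
    rw [← NNReal.coe_le_coe] at h2 h3 ⊢
    rw [← NNReal.coe_inj] at h1 h4
    push_cast at *
    rw [Real.coe_toNNReal _ (by positivity)] at *
    rw [div_mul_eq_mul_div, le_div_iff₀ (by positivity)]
    nlinarith
  have h5 := csInf_le hAbdd hmem
  rw [le_div_iff₀ (by positivity)] at h5
  change l * (2 * l) ≤ _ at h5
  nlinarith

/-- A positive operator on a cone of functions which is bounded by a multiple of the identity
is bounded below by `r` as soon as its square is bounded below by `r²`. -/
lemma ge_of_ge_sq (hfin : ∀ f ∈ K, ∀ x, f x ≠ ⊤) (hT : ∀ f ∈ K, T f ∈ K)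
    (hsmul : ∀ f ∈ K, ∀ c : ℝ, T (fun x => ENNReal.ofReal c * f x)
      = fun x => ENNReal.ofReal c * T f x)
    (hadd : ∀ f ∈ K, ∀ g ∈ K, T (f + g) = T f + T g)
    (hdiff : ∀ f ∈ K, ∀ g ∈ K, ∀ c : ℝ, (∀ x, g x ≤ ENNReal.ofReal c * f x) →
      ∃ d ∈ K, d + g = fun x => ENNReal.ofReal c * f x)
    {C r : ℝ} (hC : ∀ f ∈ K, ∀ x, T f x ≤ ENNReal.ofReal C * f x) (hr : 0 < r)
    (hsq : ∀ f ∈ K, ∀ x, ENNReal.ofReal (r ^ 2) * f x ≤ T (T f) x) :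
    ∀ f ∈ K, ∀ x, ENNReal.ofReal r * f x ≤ T f x := by
  wlog hCpos : 0 < C generalizing C
  · refine this (C := 1) (fun f hf x => (hC f hf x).trans ?_) one_pos
    gcongr
    linarith
  set A : Set ℝ := {c | 0 ≤ c ∧ c ≤ r ∧ ∀ f ∈ K, ∀ x, ENNReal.ofReal c * f x ≤ T f x} with hA
  have hAne : A.Nonempty := ⟨0, le_rfl, hr.le, fun f hf x => by simp⟩
  have hAbdd : BddAbove A := ⟨r, fun c hc => hc.2.1⟩
  have hAcl : IsClosed A := by
    rw [hA, Set.ofPred_and, Set.ofPred_and]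
    refine isClosed_Ici.inter (isClosed_Iic.inter ?_)
    simp only [Set.ofPred_forall]
    refine isClosed_iInter fun f => isClosed_iInter fun hf => isClosed_iInter fun x => ?_
    refine isClosed_le ?_ continuous_const
    exact (ENNReal.continuous_mul_const (hfin f hf x)).comp ENNReal.continuous_ofReal
  set m := sSup A
  have hm : m ∈ A := hAcl.csSup_mem hAne hAbdd
  obtain ⟨hm0, hmr, hmT⟩ := hm
  suffices r ≤ m by rwa [le_antisymm this hmr]
  have key (f) (hf : f ∈ K) (x) : ENNReal.ofReal ((r ^ 2 + m * C) / (C + m)) * f x ≤ T f x := by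
    obtain ⟨d, hd, hde⟩ := hdiff f hf (T f) (hT f hf) C (hC f hf)
    have h1 := congrFun (hadd d hd (T f) (hT f hf)) x
    rw [hde, hsmul f hf] at h1
    have h2 := hmT d hd x
    have h3 := hsq f hf x
    have h4 := congrFun hde x
    simp only [Pi.add_apply] at h1 h4
    have e1 := hfin _ hf x
    have e2 := hfin _ (hT _ hf) x
    have e3 := hfin _ (hT _ (hT _ hf)) x
    have e4 := hfin _ hd x
    have e5 := hfin _ (hT _ hd) x
    lift f x to NNReal using e1 with a
    lift T f x to NNReal using e2 with b
    lift T (T f) x to NNReal using e3 with c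
    lift d x to NNReal using e4 with s
    lift T d x to NNReal using e5 with t
    simp only [ENNReal.ofReal] at *
    norm_cast at *
    rw [← NNReal.coe_le_coe] at h2 h3 ⊢
    rw [← NNReal.coe_inj] at h1 h4
    push_cast at *
    have f1 : ((m.toNNReal : NNReal) : ℝ) = m := Real.coe_toNNReal _ hm0
    have f2 : ((C.toNNReal : NNReal) : ℝ) = C := Real.coe_toNNReal _ hCpos.le
    have f3 : (((r ^ 2).toNNReal : NNReal) : ℝ) = r ^ 2 := Real.coe_toNNReal _ (by positivity)
    rw [f1] at h2
    rw [f2] at h1 h4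
    rw [f3] at h3
    rw [Real.coe_toNNReal _ (by positivity), div_mul_eq_mul_div, div_le_iff₀ (by positivity)]
    nlinarith
  by_contra! hlt
  have hgt : m < (r ^ 2 + m * C) / (C + m) := by
    rw [lt_div_iff₀ (by positivity)]; nlinarith
  have hmem : min r ((r ^ 2 + m * C) / (C + m)) ∈ A :=
    ⟨by positivity, min_le_left _ _, fun f hf x => le_trans (by
      gcongr; exact min_le_right _ _) (key f hf x)⟩
  exact absurd (le_csSup hAbdd hmem) (not_le.2 (lt_min hlt hgt))

end SquareRoot

section Shift

variable {G : Type*} [Group G] {p : G → G → ℝ≥0∞} {E : Set G} {v : G} {w w₁ w₂ f : G → ℝ≥0∞}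

/-- The translation operator `T_v f (x) = f (x v)` on functions supported by `E`. -/
noncomputable def shift (E : Set G) (v : G) (f : G → ℝ≥0∞) (x : G) : ℝ≥0∞ :=
  if x ∈ E then f (x * v) else 0

/-- Translation by `v` preserves `E` and increases the transition probabilities. -/
structure IsAdmissible (p : G → G → ℝ≥0∞) (E : Set G) (v : G) : Prop where
  mem : ∀ x ∈ E, x * v ∈ E
  mono : ∀ x ∈ E, ∀ y ∈ E, p x y ≤ p (x * v) (y * v)

lemma IsAdmissible.one : IsAdmissible p E 1 := ⟨by simp, by simp⟩

lemma IsAdmissible.mul {v₁ v₂ : G} (h₁ : IsAdmissible p E v₁) (h₂ : IsAdmissible p E v₂) :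
    IsAdmissible p E (v₁ * v₂) := by
  refine ⟨fun x hx => ?_, fun x hx y hy => ?_⟩
  · rw [← mul_assoc]; exact h₂.mem _ (h₁.mem x hx)
  · rw [← mul_assoc, ← mul_assoc]
    exact (h₁.mono x hx y hy).trans (h₂.mono _ (h₁.mem x hx) _ (h₁.mem y hy))

lemma IsAdmissible.pow (hv : IsAdmissible p E v) (n : ℕ) : IsAdmissible p E (v ^ n) := by
  induction n with
  | zero => simpa using IsAdmissible.one
  | succ n ih => rw [pow_succ]; exact ih.mul hv

lemma shift_add (f g : G → ℝ≥0∞) : shift E v (f + g) = shift E v f + shift E v g := by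
  funext x
  by_cases hx : x ∈ E <;> simp [shift, hx]

lemma shift_const_mul (c : ℝ≥0∞) (f : G → ℝ≥0∞) :
    shift E v (fun x => c * f x) = fun x => c * shift E v f x := by
  funext x
  by_cases hx : x ∈ E <;> simp [shift, hx]

lemma shift_mono : Monotone (shift E v) := fun f g hfg x => by
  by_cases hx : x ∈ E <;> simp [shift, hx, hfg (x * v)]

lemma IsAdmissible.shift_shift (hv : IsAdmissible p E v) (f : G → ℝ≥0∞) :
    shift E v (shift E v f) = shift E (v * v) f := by
  funext x
  by_cases hx : x ∈ E <;> simp [shift, hx, hv.mem, mul_assoc]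

lemma IsAdmissible.kapp_shift_le (hsupp : ∀ x y, p x y ≠ 0 → x ∈ E ∧ y ∈ E)
    (hv : IsAdmissible p E v) (f : G → ℝ≥0∞) : kapp p (shift E v f) ≤ shift E v (kapp p f) := by
  intro x
  by_cases hx : x ∈ E
  · simp only [shift, hx, if_true, kapp]
    rw [← (Equiv.mulRight v).tsum_eq (fun y => p (x * v) y * f y)]
    refine ENNReal.tsum_le_tsum fun y => ?_
    by_cases hy : y ∈ E
    · simp only [hy, if_true, Equiv.coe_mulRight]
      gcongr
      exact hv.mono x hx y hy
    · simp [hy]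
  · rw [kapp_eq_zero_of_notMem hsupp hx]; exact zero_le

lemma IsAdmissible.kapp_iterate_shift_le (hsupp : ∀ x y, p x y ≠ 0 → x ∈ E ∧ y ∈ E)
    (hv : IsAdmissible p E v) (k : ℕ) (f : G → ℝ≥0∞) :
    (kapp p)^[k] (shift E v f) ≤ shift E v ((kapp p)^[k] f) := by
  induction k generalizing f with
  | zero => exact le_rfl
  | succ k ih =>
    exact (kapp_iterate_mono k (hv.kapp_shift_le hsupp f)).trans (ih _)

lemma IsSuper.shift (hsupp : ∀ x y, p x y ≠ 0 → x ∈ E ∧ y ∈ E) (hv : IsAdmissible p E v)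
    (hw : IsSuper p w) : IsSuper p (shift E v w) := by
  refine ⟨fun x => ?_, (hv.kapp_shift_le hsupp w).trans (shift_mono hw.2)⟩
  by_cases hx : x ∈ E <;> simp [RW.shift, hx, hw.1]

lemma harmPart_shift_eq_zero (hsupp : ∀ x y, p x y ≠ 0 → x ∈ E ∧ y ∈ E)
    (hv : IsAdmissible p E v) (h0 : harmPart p w = 0) : harmPart p (shift E v w) = 0 := by
  funext x
  refine le_antisymm ?_ zero_le
  calc harmPart p (shift E v w) x ≤ ⨅ k, shift E v ((kapp p)^[k] w) x :=
        iInf_mono fun k => hv.kapp_iterate_shift_le hsupp k w x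
    _ = shift E v (harmPart p w) x := by
        by_cases hx : x ∈ E <;> simp [shift, hx, harmPart]
    _ = 0 := by simp [h0, shift]

lemma harmPart_shift_harmPart (hsupp : ∀ x y, p x y ≠ 0 → x ∈ E ∧ y ∈ E)
    (hv : IsAdmissible p E v) (hw : IsSuper p w) :
    harmPart p (shift E v (harmPart p w)) = harmPart p (shift E v w) := by
  obtain ⟨φ, hφ⟩ := hw.exists_charge
  conv_rhs => rw [← hw.riesz hφ]
  rw [shift_add, (hw.isHarm_harmPart.isSuper.shift hsupp hv).harmPart_add
    ((hw.greenApp_of_charge hφ).shift hsupp hv),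
    harmPart_shift_eq_zero hsupp hv (hw.harmPart_greenApp hφ), add_zero]

/-- The harmonic part of the translate of `f` by `v`. -/
noncomputable def harmShift (p : G → G → ℝ≥0∞) (E : Set G) (v : G) (f : G → ℝ≥0∞) : G → ℝ≥0∞ :=
  harmPart p (shift E v f)

lemma harmShift_harmShift (hsupp : ∀ x y, p x y ≠ 0 → x ∈ E ∧ y ∈ E)
    (hv : IsAdmissible p E v) (hf : IsHarm p f) :
    harmShift p E v (harmShift p E v f) = harmShift p E (v * v) f := by
  rw [harmShift, harmShift, harmPart_shift_harmPart hsupp hv (hf.isSuper.shift hsupp hv),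
    hv.shift_shift, harmShift]

lemma IsHarm.harmShift_le (hf : IsHarm p f) {c : ℝ≥0∞} (hc : c ≠ ⊤)
    (h : ∀ x ∈ E, f (x * v) ≤ c * f x) (x : G) : harmShift p E v f x ≤ c * f x := by
  have h1 : shift E v f ≤ fun x => c * f x := fun x => by
    by_cases hx : x ∈ E <;> simp [shift, hx, h]
  have h2 := harmPart_mono (p := p) h1 x
  rw [(hf.const_mul hc).harmPart_eq] at h2
  exact h2

lemma IsHarm.le_harmShift (hsupp : ∀ x y, p x y ≠ 0 → x ∈ E ∧ y ∈ E) (hf : IsHarm p f)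
    {c : ℝ≥0∞} (hc : c ≠ ⊤) (h : ∀ x ∈ E, c * f x ≤ f (x * v)) (x : G) :
    c * f x ≤ harmShift p E v f x := by
  have h1 : (fun x => c * f x) ≤ shift E v f := fun x => by
    by_cases hx : x ∈ E
    · simp [shift, hx, h]
    · have h0 : f x = 0 := by rw [← hf.2, kapp_eq_zero_of_notMem hsupp hx]
      simp [shift, hx, h0]
  have h2 := harmPart_mono (p := p) h1 x
  rw [(hf.const_mul hc).harmPart_eq] at h2
  exact h2

variable {C r : ℝ}

lemma harmShift_add (hsupp : ∀ x y, p x y ≠ 0 → x ∈ E ∧ y ∈ E) (hv : IsAdmissible p E v)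
    {g : G → ℝ≥0∞} (hf : IsHarm p f) (hg : IsHarm p g) :
    harmShift p E v (f + g) = harmShift p E v f + harmShift p E v g := by
  rw [harmShift, shift_add, (hf.isSuper.shift hsupp hv).harmPart_add (hg.isSuper.shift hsupp hv)]
  rfl

lemma harmShift_const_mul {c : ℝ≥0∞} (hc : c ≠ ⊤) (f : G → ℝ≥0∞) :
    harmShift p E v (fun x => c * f x) = fun x => c * harmShift p E v f x := by
  rw [harmShift, shift_const_mul, harmPart_const_mul hc]
  rfl

lemma harmShift_le_of_sq (hsupp : ∀ x y, p x y ≠ 0 → x ∈ E ∧ y ∈ E) (hv : IsAdmissible p E v)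
    (hC : ∀ f, IsHarm p f → ∀ x, harmShift p E v f x ≤ ENNReal.ofReal C * f x) (hr : 0 < r)
    (hsq : ∀ f, IsHarm p f → ∀ x, harmShift p E (v * v) f x ≤ ENNReal.ofReal (r ^ 2) * f x) :
    ∀ f, IsHarm p f → ∀ x, harmShift p E v f x ≤ ENNReal.ofReal r * f x :=
  le_of_sq_le (T := harmShift p E v) (K := {f | IsHarm p f}) (fun f hf => hf.1)
    (fun f hf => (hf.isSuper.shift hsupp hv).isHarm_harmPart)
    (fun f _ c => harmShift_const_mul ENNReal.ofReal_ne_top f)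
    (fun f hf g hg => harmShift_add hsupp hv hf hg)
    (fun f hf g hg c hle => exists_isHarm_sub hf hg c hle) hC hr
    (fun f hf x => by rw [harmShift_harmShift hsupp hv hf]; exact hsq f hf x)

lemma le_harmShift_of_sq (hsupp : ∀ x y, p x y ≠ 0 → x ∈ E ∧ y ∈ E) (hv : IsAdmissible p E v)
    (hC : ∀ f, IsHarm p f → ∀ x, harmShift p E v f x ≤ ENNReal.ofReal C * f x) (hr : 0 < r)
    (hsq : ∀ f, IsHarm p f → ∀ x, ENNReal.ofReal (r ^ 2) * f x ≤ harmShift p E (v * v) f x) :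
    ∀ f, IsHarm p f → ∀ x, ENNReal.ofReal r * f x ≤ harmShift p E v f x :=
  ge_of_ge_sq (T := harmShift p E v) (K := {f | IsHarm p f}) (fun f hf => hf.1)
    (fun f hf => (hf.isSuper.shift hsupp hv).isHarm_harmPart)
    (fun f _ c => harmShift_const_mul ENNReal.ofReal_ne_top f)
    (fun f hf g hg => harmShift_add hsupp hv hf hg)
    (fun f hf g hg c hle => exists_isHarm_sub hf hg c hle) hC hr
    (fun f hf x => by rw [harmShift_harmShift hsupp hv hf]; exact hsq f hf x)

lemma harmShift_le_of_two_pow (hsupp : ∀ x y, p x y ≠ 0 → x ∈ E ∧ y ∈ E) (hr : 0 < r)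
    (k : ℕ) (hv : IsAdmissible p E v)
    (hC : ∀ n, ∃ C : ℝ, ∀ f, IsHarm p f → ∀ x,
      harmShift p E (v ^ n) f x ≤ ENNReal.ofReal C * f x)
    (hk : ∀ f, IsHarm p f → ∀ x,
      harmShift p E (v ^ 2 ^ k) f x ≤ ENNReal.ofReal (r ^ 2 ^ k) * f x) :
    ∀ f, IsHarm p f → ∀ x, harmShift p E v f x ≤ ENNReal.ofReal r * f x := by
  induction k with
  | zero => simpa using hk
  | succ k ih =>
    obtain ⟨C, hC'⟩ := hC (2 ^ k)
    refine ih (harmShift_le_of_sq hsupp (hv.pow _) hC' (by positivity) ?_)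
    rwa [← pow_two, ← pow_mul, ← pow_mul, ← pow_succ]

lemma le_harmShift_of_two_pow (hsupp : ∀ x y, p x y ≠ 0 → x ∈ E ∧ y ∈ E) (hr : 0 < r)
    (k : ℕ) (hv : IsAdmissible p E v)
    (hC : ∀ n, ∃ C : ℝ, ∀ f, IsHarm p f → ∀ x,
      harmShift p E (v ^ n) f x ≤ ENNReal.ofReal C * f x)
    (hk : ∀ f, IsHarm p f → ∀ x,
      ENNReal.ofReal (r ^ 2 ^ k) * f x ≤ harmShift p E (v ^ 2 ^ k) f x) :
    ∀ f, IsHarm p f → ∀ x, ENNReal.ofReal r * f x ≤ harmShift p E v f x := by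
  induction k with
  | zero => simpa using hk
  | succ k ih =>
    obtain ⟨C, hC'⟩ := hC (2 ^ k)
    refine ih (le_harmShift_of_sq hsupp (hv.pow _) hC' (by positivity) ?_)
    rwa [← pow_two, ← pow_mul, ← pow_mul, ← pow_succ]

lemma exp_le_of_abs_log_div_lt {q : ℝ≥0∞} (h0 : 0 < q) (h1 : q ≤ 1) {ε : ℝ} {n : ℕ}
    (hn : 0 < n) (h : |Real.log q.toReal / n| < ε) : ENNReal.ofReal (Real.exp (-(ε * n))) ≤ q := by
  have hq : q ≠ ⊤ := ne_top_of_le_ne_top ENNReal.one_ne_top h1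
  rw [ENNReal.ofReal_le_iff_le_toReal hq]
  have hpos : 0 < q.toReal := ENNReal.toReal_pos h0.ne' hq
  rw [← Real.le_log_iff_exp_le hpos]
  have := (abs_lt.1 h).1
  rw [lt_div_iff₀ (by positivity)] at this
  linarith

lemma le_exp_mul_of_exp_neg_mul_le {t : ℝ} {a b : ℝ≥0∞}
    (h : ENNReal.ofReal (Real.exp (-t)) * a ≤ b) :
    a ≤ ENNReal.ofReal (Real.exp t) * b := by
  calc a = ENNReal.ofReal (Real.exp t) * (ENNReal.ofReal (Real.exp (-t)) * a) := by
        rw [← mul_assoc, ← ENNReal.ofReal_mul (Real.exp_pos t).le, ← Real.exp_add]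
        simp
    _ ≤ _ := by gcongr

/-- Subexponential two-sided Harnack bounds along the powers of `u`. -/
def SlowBounds (p : G → G → ℝ≥0∞) (E : Set G) (u : G) : Prop :=
  ∀ ε : ℝ, 0 < ε → ∃ N : ℕ, ∀ n ≥ N, ∀ f, IsHarm p f → ∀ x ∈ E,
    f (x * u ^ n) ≤ ENNReal.ofReal (Real.exp (ε * n)) * f x ∧
    f x ≤ ENNReal.ofReal (Real.exp (ε * n)) * f (x * u ^ n)

lemma SlowBounds.exists_harmShift_le {u : G} (hb : SlowBounds p E u) (hu : IsAdmissible p E u)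
    (n : ℕ) : ∃ C : ℝ, ∀ f, IsHarm p f → ∀ x,
      harmShift p E (u ^ n) f x ≤ ENNReal.ofReal C * f x := by
  obtain ⟨N, hN⟩ := hb 1 one_pos
  refine ⟨Real.exp (1 * N) * Real.exp (1 * (n + N : ℕ)), fun f hf =>
    hf.harmShift_le ENNReal.ofReal_ne_top fun x hx => ?_⟩
  have h1 := (hN N le_rfl f hf (x * u ^ n) ((hu.pow n).mem x hx)).2
  have h2 := (hN (n + N) (by omega) f hf x hx).1
  rw [mul_assoc, ← pow_add] at h1
  rw [ENNReal.ofReal_mul (Real.exp_pos _).le, mul_assoc]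
  exact h1.trans (by gcongr)

lemma SlowBounds.harmShift_eq (hsupp : ∀ x y, p x y ≠ 0 → x ∈ E ∧ y ∈ E) {u : G}
    (hb : SlowBounds p E u) (hu : IsAdmissible p E u) (hf : IsHarm p f) :
    harmShift p E u f = f := by
  have hC := hb.exists_harmShift_le hu
  have hexp (s : ℝ) (n : ℕ) : Real.exp (s * n) = Real.exp s ^ n := by
    rw [← Real.exp_nat_mul, mul_comm]
  have hlim (s : ℝ) (x : G) : Tendsto (fun ε : ℝ => ENNReal.ofReal (Real.exp (s * ε)) * f x)
      (nhdsWithin 0 (Set.Ioi 0)) (nhds (f x)) := by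
    have hc : Continuous fun ε : ℝ => ENNReal.ofReal (Real.exp (s * ε)) * f x :=
      (ENNReal.continuous_mul_const (hf.1 x)).comp
        (ENNReal.continuous_ofReal.comp (by fun_prop))
    have := hc.tendsto 0
    simp only [mul_zero, Real.exp_zero, ENNReal.ofReal_one, one_mul] at this
    exact this.mono_left nhdsWithin_le_nhds
  have hN (N : ℕ) : N ≤ 2 ^ N := Nat.lt_two_pow_self.le
  funext x
  refine le_antisymm (ge_of_tendsto (hlim 1 x) ?_) (le_of_tendsto (hlim (-1) x) ?_)
  · filter_upwards [self_mem_nhdsWithin] with ε hε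
    obtain ⟨N, hbN⟩ := hb ε hε
    refine harmShift_le_of_two_pow hsupp (Real.exp_pos _) N hu hC (fun g hg => ?_) f hf x
    refine hg.harmShift_le ENNReal.ofReal_ne_top fun z hz => ?_
    rw [one_mul, ← hexp]
    exact (hbN _ (hN N) g hg z hz).1
  · filter_upwards [self_mem_nhdsWithin] with ε hε
    obtain ⟨N, hbN⟩ := hb ε hε
    refine le_harmShift_of_two_pow hsupp (Real.exp_pos _) N hu hC (fun g hg => ?_) f hf x
    refine hg.le_harmShift hsupp ENNReal.ofReal_ne_top fun z hz => ?_
    rw [← hexp, neg_one_mul, neg_mul]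
    calc _ ≤ ENNReal.ofReal (Real.exp (-(ε * (2 ^ N : ℕ)))) *
          (ENNReal.ofReal (Real.exp (ε * (2 ^ N : ℕ))) * g (z * u ^ 2 ^ N)) := by
          gcongr
          exact (hbN _ (hN N) g hg z hz).2
      _ = g (z * u ^ 2 ^ N) := by
          rw [← mul_assoc, ← ENNReal.ofReal_mul (Real.exp_pos _).le, ← Real.exp_add]
          simp

lemma slowBounds_of_tendstoUniformlyOn {u : G} (hsub : ∀ x, (∑' y, p x y) ≤ 1)
    (hirr : ∀ x ∈ E, ∀ y ∈ E, 0 < hitProb p x y) (hu : IsAdmissible p E u)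
    (hsv1 : TendstoUniformlyOn
      (fun (n : ℕ) (x : G) => Real.log ((hitProb p x (x * u ^ n)).toReal) / n)
      (fun _ => 0) atTop E)
    (hsv2 : TendstoUniformlyOn
      (fun (n : ℕ) (x : G) => Real.log ((hitProb p (x * u ^ n) x).toReal) / n)
      (fun _ => 0) atTop E) : SlowBounds p E u := by
  intro ε hε
  rw [Metric.tendstoUniformlyOn_iff] at hsv1 hsv2
  obtain ⟨N, hN⟩ := eventually_atTop.1 (((hsv1 ε hε).and (hsv2 ε hε)).and (eventually_gt_atTop 0))
  refine ⟨N, fun n hn f hf x hx => ?_⟩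
  obtain ⟨⟨h1, h2⟩, hn0⟩ := hN n hn
  have h1 := h1 x hx
  have h2 := h2 x hx
  rw [dist_zero_left, Real.norm_eq_abs] at h1 h2
  have hxu := (hu.pow n).mem x hx
  constructor
  · refine le_exp_mul_of_exp_neg_mul_le (le_trans ?_ (hitProb_mul_le hf.2.le x (x * u ^ n)))
    gcongr
    exact exp_le_of_abs_log_div_lt (hirr _ hx _ hxu) (hitProb_le_one hsub _ _) hn0 h1
  · refine le_exp_mul_of_exp_neg_mul_le (le_trans ?_ (hitProb_mul_le hf.2.le (x * u ^ n) x))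
    gcongr
    exact exp_le_of_abs_log_div_lt (hirr _ hxu _ hx) (hitProb_le_one hsub _ _) hn0 h2

lemma Aop_add_kapp_shift {u : G} (hu : IsAdmissible p E u) (f : G → ℝ≥0∞) {x : G} (hx : x ∈ E) :
    Aop p E u f x + kapp p (shift E u f) x = kapp p f (x * u) := by
  simp only [Aop, kapp]
  rw [← (Equiv.mulRight u⁻¹).tsum_eq (fun y => p x y * shift E u f y), ← ENNReal.tsum_add]
  refine tsum_congr fun y => ?_
  by_cases hy : y * u⁻¹ ∈ E
  · simp only [acoef, hy, if_true, Equiv.coe_mulRight, shift, inv_mul_cancel_right]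
    rw [← add_mul, tsub_add_cancel_of_le]
    simpa using hu.mono x hx _ hy
  · simp [acoef, hy, shift]

end Shift

end RW

theorem statement5 {G : Type*} [Group G] [Countable G]
    (p : G → G → ℝ≥0∞) (E : Set G)
    (hsupp : ∀ x y, p x y ≠ 0 → x ∈ E ∧ y ∈ E)
    (hsub : ∀ x, (∑' y, p x y) ≤ 1)
    (hirr : ∀ x ∈ E, ∀ y ∈ E, 0 < hitProb p x y)
    (htrans : ∀ x ∈ E, green p x x < ⊤)
    (u : G) (hu : u ∈ E)
    (hEu : ∀ x ∈ E, x * u ∈ E)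
    (hmono : ∀ x ∈ E, ∀ y ∈ E, p x y ≤ p (x * u) (y * u))
    (hsv1 : TendstoUniformlyOn
      (fun (n : ℕ) (x : G) => Real.log ((hitProb p x (x * u ^ n)).toReal) / n)
      (fun _ => 0) atTop E)
    (hsv2 : TendstoUniformlyOn
      (fun (n : ℕ) (x : G) => Real.log ((hitProb p (x * u ^ n) x).toReal) / n)
      (fun _ => 0) atTop E)
    (h : G → ℝ≥0∞) (hfin : ∀ x ∈ E, h x ≠ ⊤) (hne : ∃ x ∈ E, h x ≠ 0)
    (hharm : ∀ x ∈ E, kapp p h x = h x) :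
    ∀ y ∈ E, h (y * u) = h y + greenApp p (Aop p E u h) y := by
  have hu' : IsAdmissible p E u := ⟨hEu, hmono⟩
  have hon : Set.EqOn (E.indicator h) h E := Set.eqOn_indicator
  have hH : IsHarm p (E.indicator h) := by
    refine ⟨fun x => ?_, ?_⟩
    · by_cases hx : x ∈ E <;> simp [hx, hfin]
    · funext x
      by_cases hx : x ∈ E
      · rw [kapp_congr hsupp hon, hharm x hx, hon hx]
      · rw [kapp_eq_zero_of_notMem hsupp hx, Set.indicator_of_notMem hx]
  have hcharge : E.indicator (Aop p E u h) + kapp p (shift E u (E.indicator h))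
      = shift E u (E.indicator h) := by
    have hshift : Set.EqOn (shift E u (E.indicator h)) (shift E u h) E := fun x hx => by
      simp [shift, hx, hEu]
    funext x
    by_cases hx : x ∈ E
    · rw [kapp_congr hsupp hshift, Pi.add_apply, Set.indicator_of_mem hx,
        Aop_add_kapp_shift hu' h hx, hharm _ (hEu x hx)]
      simp [shift, hx, hEu]
    · simp [hx, shift, kapp_eq_zero_of_notMem hsupp hx]
  intro y hy
  have hriesz := congrFun ((hH.isSuper.shift hsupp hu').riesz hcharge) y
  have hS := (slowBounds_of_tendstoUniformlyOn hsub hirr hu' hsv1 hsv2).harmShift_eq hsupp hu' hH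
  rw [harmShift] at hS
  rw [Pi.add_apply, hS, hon hy, greenApp_eqOn hsupp Set.eqOn_indicator hy] at hriesz
  simpa [shift, hy, hEu] using hriesz.symm
end

section
/- Under (A0), (B1), (B2), the renewal function V(x) = 𝔼_x(𝒯_ϑ) satisfies V(e) = 1, V is superharmonic for the killed chain (X(t)), and the function (I − P)V is constant on E. -/
open scoped ENNReal Classical BigOperators
open Filter

open RW

theorem ENNReal.tsum_iSup_of_monotone {ι : Type*} {f : ℕ → ι → ℝ≥0∞} (hf : Monotone f) :
    ∑' i, ⨆ n, f n i = ⨆ n, ∑' i, f n i := by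
  simp_rw [ENNReal.tsum_eq_iSup_sum]
  rw [iSup_comm]
  exact iSup_congr fun s => ENNReal.finsetSum_iSup_of_monotone fun i _ _ h => hf h i

/-- The sequence `f` increases to `a`. -/
def IncreasesTo (f : ℕ → ℝ≥0∞) (a : ℝ≥0∞) : Prop := Monotone f ∧ ⨆ n, f n = a

namespace IncreasesTo

theorem tendsto {f : ℕ → ℝ≥0∞} {a : ℝ≥0∞} (h : IncreasesTo f a) :
    Tendsto f atTop (nhds a) := h.2 ▸ tendsto_atTop_iSup h.1

theorem const (a : ℝ≥0∞) : IncreasesTo (fun _ => a) a := ⟨monotone_const, iSup_const⟩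

theorem mul {f g : ℕ → ℝ≥0∞} {a b : ℝ≥0∞} (hf : IncreasesTo f a) (hg : IncreasesTo g b) :
    IncreasesTo (fun n => f n * g n) (a * b) := by
  refine ⟨fun m n h => mul_le_mul' (hf.1 h) (hg.1 h), ?_⟩
  rw [← hf.2, ← hg.2, ENNReal.iSup_mul]
  simp_rw [ENNReal.mul_iSup]
  refine le_antisymm (iSup_le fun n => le_iSup₂_of_le n n le_rfl) (iSup₂_le fun m n => ?_)
  exact le_iSup_of_le (max m n)
    (mul_le_mul' (hf.1 (le_max_left m n)) (hg.1 (le_max_right m n)))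

theorem tsum {ι : Type*} {f : ℕ → ι → ℝ≥0∞} {a : ι → ℝ≥0∞}
    (h : ∀ i, IncreasesTo (fun n => f n i) (a i)) :
    IncreasesTo (fun n => ∑' i, f n i) (∑' i, a i) := by
  refine ⟨fun m n hmn => ENNReal.tsum_le_tsum fun i => (h i).1 hmn, ?_⟩
  rw [← ENNReal.tsum_iSup_of_monotone fun m n hmn i => (h i).1 hmn]
  exact tsum_congr fun i => (h i).2

end IncreasesTo

namespace RW

section Kernel

variable {G : Type*} {q : G → G → ℝ≥0∞}

theorem kapp_kiter_zero (d : G → ℝ≥0∞) (x : G) : kapp (kiter q 0) d x = d x := by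
  rw [kapp, tsum_eq_single x fun y hy => by simp [kiter, hy.symm]]
  simp [kiter]

theorem kapp_kiter_succ (n : ℕ) (d : G → ℝ≥0∞) (x : G) :
    kapp (kiter q (n + 1)) d x = kapp q (kapp (kiter q n) d) x := by
  simp only [kapp, kiter, ← ENNReal.tsum_mul_right, ← ENNReal.tsum_mul_left]
  rw [ENNReal.tsum_comm]
  simp only [mul_assoc]

theorem greenApp_eq_tsum (d : G → ℝ≥0∞) (x : G) :
    greenApp q d x = ∑' n, kapp (kiter q n) d x := by
  simp only [greenApp, green, kapp, ← ENNReal.tsum_mul_right]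
  rw [ENNReal.tsum_comm]

theorem kapp_tsum {ι : Type*} (f : ι → G → ℝ≥0∞) (x : G) :
    kapp q (fun y => ∑' i, f i y) x = ∑' i, kapp q (f i) x := by
  simp only [kapp, ← ENNReal.tsum_mul_left]
  rw [ENNReal.tsum_comm]

theorem kapp_sum {ι : Type*} (s : Finset ι) (f : ι → G → ℝ≥0∞) (x : G) :
    kapp q (fun y => ∑ i ∈ s, f i y) x = ∑ i ∈ s, kapp q (f i) x := by
  simp only [kapp, Finset.mul_sum]
  rw [Summable.tsum_finsetSum fun _ _ => ENNReal.summable]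

theorem kapp_mono_s12 {S : Set G} {x : G} {f g : G → ℝ≥0∞} (hq : ∀ y, q x y ≠ 0 → y ∈ S)
    (h : ∀ y ∈ S, f y ≤ g y) : kapp q f x ≤ kapp q g x := by
  refine ENNReal.tsum_le_tsum fun y => ?_
  by_cases hy : q x y = 0
  · simp [hy]
  · exact mul_le_mul_right (h y (hq y hy)) _

theorem greenApp_eq_add (d : G → ℝ≥0∞) (x : G) :
    greenApp q d x = d x + kapp q (greenApp q d) x := by
  rw [show greenApp q d = fun y => ∑' n, kapp (kiter q n) d y from
    funext fun y => greenApp_eq_tsum d y, kapp_tsum]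
  simp only
  rw [tsum_eq_zero_add' ENNReal.summable, kapp_kiter_zero]
  simp only [kapp_kiter_succ]

theorem greenApp_add (d d' : G → ℝ≥0∞) (x : G) :
    greenApp q (fun y => d y + d' y) x = greenApp q d x + greenApp q d' x := by
  simp only [greenApp, mul_add, ENNReal.tsum_add]

/-- The potential of `d` is the minimal solution of `d + q f ≤ f`. -/
theorem greenApp_le {S : Set G} (hq : ∀ x ∈ S, ∀ y, q x y ≠ 0 → y ∈ S) {d f : G → ℝ≥0∞}
    (h : ∀ x ∈ S, d x + kapp q f x ≤ f x) : ∀ x ∈ S, greenApp q d x ≤ f x := by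
  intro x hx
  rw [greenApp_eq_tsum]
  refine ENNReal.tsum_le_of_sum_range_le fun n => ?_
  induction n generalizing x with
  | zero => simp
  | succ n ih =>
    refine le_trans ?_ (h x hx)
    rw [Finset.sum_range_succ', kapp_kiter_zero, add_comm]
    simp only [kapp_kiter_succ]
    rw [← kapp_sum]
    exact add_le_add_right (kapp_mono_s12 (hq x hx) ih) _

theorem surv_eq (n : ℕ) (x : G) : surv q n x = kapp (kiter q n) (fun _ => 1) x := by
  simp [surv, kapp]

theorem gexp_eq_greenApp (x : G) : gexp q x = greenApp q (fun _ => 1) x := by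
  simp only [gexp, surv_eq, greenApp_eq_tsum]

theorem gexp_eq_add (x : G) : gexp q x = 1 + kapp q (gexp q) x := by
  rw [show gexp q = greenApp q (fun _ => 1) from funext gexp_eq_greenApp]
  exact greenApp_eq_add _ x

theorem one_le_gexp (x : G) : 1 ≤ gexp q x := by
  rw [gexp_eq_add]
  exact le_self_add

theorem surv_le_pow {r : ℝ≥0∞} (hr : ∀ x, ∑' y, q x y ≤ r) (n : ℕ) (x : G) :
    surv q n x ≤ r ^ n := by
  induction n generalizing x with
  | zero => simp [surv_eq, kapp_kiter_zero]
  | succ n ih =>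
    rw [surv_eq, kapp_kiter_succ]
    calc kapp q (kapp (kiter q n) fun _ => 1) x
        ≤ kapp q (fun _ => r ^ n) x :=
          kapp_mono_s12 (S := Set.univ) (by simp) fun y _ => surv_eq n y ▸ ih y
      _ = (∑' y, q x y) * r ^ n := ENNReal.tsum_mul_right
      _ ≤ r * r ^ n := mul_le_mul_left (hr x) _
      _ = r ^ (n + 1) := (pow_succ' r n).symm

theorem gexp_lt_top {r : ℝ≥0∞} (hr : ∀ x, ∑' y, q x y ≤ r) (h1 : r < 1) (x : G) :
    gexp q x < ⊤ := by
  refine (ENNReal.tsum_le_tsum fun n => surv_le_pow hr n x).trans_lt ?_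
  rw [ENNReal.tsum_geometric]
  exact ENNReal.inv_lt_top.2 (tsub_pos_of_lt h1)

theorem IncreasesTo.kiter {Q : ℕ → G → G → ℝ≥0∞}
    (h : ∀ x y, IncreasesTo (fun k => Q k x y) (q x y)) (n : ℕ) (x y : G) :
    IncreasesTo (fun k => kiter (Q k) n x y) (kiter q n x y) := by
  induction n generalizing x with
  | zero => exact .const _
  | succ n ih => exact .tsum fun z => (h x z).mul (ih z)

theorem IncreasesTo.gexp {Q : ℕ → G → G → ℝ≥0∞}
    (h : ∀ x y, IncreasesTo (fun k => Q k x y) (q x y)) (x : G) :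
    IncreasesTo (fun k => gexp (Q k) x) (gexp q x) :=
  .tsum fun n => .tsum fun y => .kiter h n x y

theorem lt_top_of_fhit_ne_zero {f : G → ℝ≥0∞} {S : Set G} (hS : ∀ x ∈ S, ∀ y, q x y ≠ 0 → y ∈ S)
    (hf : ∀ x ∈ S, kapp q f x ≤ f x) (n : ℕ) {x y : G} (hx : x ∈ S) (hfx : f x < ⊤)
    (h : fhit q n x y ≠ 0) : f y < ⊤ := by
  have step : ∀ x ∈ S, f x < ⊤ → ∀ z, q x z ≠ 0 → f z < ⊤ := by
    intro x hx hfx z hz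
    have h1 : q x z * f z < ⊤ := ((ENNReal.le_tsum z).trans (hf x hx)).trans_lt hfx
    exact ENNReal.lt_top_of_mul_ne_top_right h1.ne hz
  match n, h with
  | 0, h => exact absurd rfl h
  | 1, h => exact step x hx hfx y h
  | n + 2, h =>
    obtain ⟨z, hz⟩ : ∃ z, (if z = y then 0 else q x z * fhit q (n + 1) z y) ≠ 0 := by
      by_contra! hc
      exact h (ENNReal.tsum_eq_zero.2 hc)
    split_ifs at hz with hzy
    · exact absurd rfl hz
    · have hqz := left_ne_zero_of_mul hz
      exact lt_top_of_fhit_ne_zero hS hf (n + 1) (hS x hx z hqz) (step x hx hfx z hqz)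
        (right_ne_zero_of_mul hz)

end Kernel

section Group

variable {G : Type*} [Group G] {q : G → G → ℝ≥0∞} {E : Set G}

theorem acoef_le (u x y : G) : acoef q E u x y ≤ q (x * u) y := by
  unfold acoef
  split_ifs
  · exact tsub_le_self
  · exact le_rfl

theorem kapp_ladder (φ : G → ℝ≥0∞) (x : G) :
    kapp (ladder q E) φ x = greenApp q (Aop q E x φ) 1 := by
  simp only [kapp, ladder, greenApp, Aop, ← ENNReal.tsum_mul_right, ← ENNReal.tsum_mul_left]
  rw [ENNReal.tsum_comm]
  simp only [mul_assoc]

/-- `T_u P = A_u + P T_u` on `E`. -/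
theorem kapp_mul_eq (hsupp : ∀ x y, q x y ≠ 0 → x ∈ E ∧ y ∈ E)
    (hmono : ∀ x ∈ E, ∀ y ∈ E, ∀ u ∈ E, q x y ≤ q (x * u) (y * u))
    (φ : G → ℝ≥0∞) {z u : G} (hz : z ∈ E) (hu : u ∈ E) :
    kapp q φ (z * u) = Aop q E u φ z + kapp q (fun y => φ (y * u)) z := by
  have h : kapp q (fun y => φ (y * u)) z = ∑' y, q z (y * u⁻¹) * φ y := by
    rw [← (Equiv.mulRight u).tsum_eq]
    simp [kapp]
  rw [h, Aop, ← ENNReal.tsum_add]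
  refine tsum_congr fun y => ?_
  rw [← add_mul, acoef]
  split_ifs with hy
  · rw [tsub_add_cancel_of_le]
    simpa using hmono z hz _ hy u hu
  · rw [show q z (y * u⁻¹) = 0 from by_contra fun h => hy (hsupp _ _ h).2, add_zero]

theorem Aop_mono (hsupp : ∀ x y, q x y ≠ 0 → x ∈ E ∧ y ∈ E) {f g : G → ℝ≥0∞}
    (h : ∀ y ∈ E, f y ≤ g y) (u x : G) : Aop q E u f x ≤ Aop q E u g x :=
  kapp_mono_s12 (q := acoef q E u)
    (fun y hy => (hsupp (x * u) y fun h0 => hy (le_zero_iff.1 ((acoef_le u x y).trans_eq h0))).2) h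

theorem ladder_mem (hsupp : ∀ x y, q x y ≠ 0 → x ∈ E ∧ y ∈ E) (x y : G)
    (h : ladder q E x y ≠ 0) : y ∈ E := by
  by_contra hy
  refine h (ENNReal.tsum_eq_zero.2 fun z => ?_)
  have h0 : q (z * x) y = 0 := by_contra fun h => hy (hsupp _ _ h).2
  rw [le_zero_iff.1 ((acoef_le x z y).trans_eq h0 : acoef q E x z y ≤ 0), mul_zero]

theorem V_eq_add (x : G) : V q E x = 1 + kapp (ladder q E) (V q E) x :=
  gexp_eq_add (q := ladder q E) x

theorem V_one (hsupp : ∀ x y, q x y ≠ 0 → x ∈ E ∧ y ∈ E) : V q E 1 = 1 := by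
  have h (y : G) : ladder q E 1 y = 0 := by
    refine ENNReal.tsum_eq_zero.2 fun z => ?_
    have : acoef q E 1 z y = 0 := by
      simp only [acoef, mul_one, inv_one]
      split_ifs with hy
      · exact tsub_self _
      · exact by_contra fun h => hy (hsupp _ _ h).2
    rw [this, mul_zero]
  rw [V_eq_add]
  simp [kapp, h]

theorem greenApp_one_add_Aop (φ : G → ℝ≥0∞) (x : G) :
    greenApp q (fun z => 1 + Aop q E x φ z) 1 = gexp q 1 + kapp (ladder q E) φ x := by
  rw [greenApp_add, ← gexp_eq_greenApp, kapp_ladder]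

theorem gexp_eq_mul_V (hsupp : ∀ x y, q x y ≠ 0 → x ∈ E ∧ y ∈ E) (hone : (1 : G) ∈ E)
    (hmono : ∀ x ∈ E, ∀ y ∈ E, ∀ u ∈ E, q x y ≤ q (x * u) (y * u)) {x : G} (hx : x ∈ E) :
    gexp q x = gexp q 1 * V q E x := by
  refine le_antisymm ?_ ?_
  · set U : G → ℝ≥0∞ := fun y => gexp q 1 * V q E y with hU
    have hUeq (y : G) : gexp q 1 + kapp (ladder q E) U y = U y := by
      have h1 : kapp (ladder q E) U y = gexp q 1 * kapp (ladder q E) (V q E) y := by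
        simp only [kapp, hU, ← ENNReal.tsum_mul_left, mul_left_comm]
      rw [h1, hU]
      simp only
      rw [V_eq_add y, mul_add, mul_one]
    have key (n : ℕ) : ∀ u ∈ E, ∀ z ∈ E, ∑ k ∈ Finset.range n, surv q k (z * u) ≤
        greenApp q (fun z => 1 + Aop q E u U z) z := by
      induction n with
      | zero => simp
      | succ n ih =>
        intro u hu z hz
        rw [Finset.sum_range_succ', greenApp_eq_add]
        simp only [surv_eq, kapp_kiter_zero, kapp_kiter_succ]
        rw [← kapp_sum, kapp_mul_eq hsupp hmono _ hz hu, add_comm, ← add_assoc]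
        simp only [← surv_eq]
        refine add_le_add (add_le_add_right (Aop_mono hsupp (fun y hy => ?_) u z) _)
          (kapp_mono_s12 (fun y hy => (hsupp z y hy).2) (ih u hu))
        rw [← hUeq, ← greenApp_one_add_Aop]
        simpa using ih y hy 1 hone
    refine ENNReal.tsum_le_of_sum_range_le fun n => ?_
    change _ ≤ U x
    rw [← hUeq x, ← greenApp_one_add_Aop]
    simpa using key n x hx 1 hone
  · have h1 : gexp q 1 * V q E x = greenApp (ladder q E) (fun _ => gexp q 1) x := by
      rw [show V q E x = greenApp (ladder q E) (fun _ => 1) x from gexp_eq_greenApp x]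
      simp only [greenApp, mul_one, mul_comm (gexp q 1), ENNReal.tsum_mul_right]
    rw [h1]
    refine greenApp_le (S := E) (fun x _ y => ladder_mem hsupp x y) (fun u hu => ?_) x hx
    rw [← greenApp_one_add_Aop]
    have := greenApp_le (S := E) (q := q) (fun x _ y h => (hsupp x y h).2)
      (d := fun z => 1 + Aop q E u (gexp q) z) (f := fun z => gexp q (z * u))
      (fun z hz => by rw [gexp_eq_add (z * u), kapp_mul_eq hsupp hmono _ hz hu, add_assoc]) 1 hone
    simpa using this

theorem V_eq_kapp_add_of_lt_top (hsupp : ∀ x y, q x y ≠ 0 → x ∈ E ∧ y ∈ E) (hone : (1 : G) ∈ E)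
    (hmono : ∀ x ∈ E, ∀ y ∈ E, ∀ u ∈ E, q x y ≤ q (x * u) (y * u))
    (hfin : gexp q 1 < ⊤) {x : G} (hx : x ∈ E) :
    V q E x = kapp q (V q E) x + (gexp q 1)⁻¹ := by
  have h0 : gexp q 1 ≠ 0 := (zero_lt_one.trans_le (one_le_gexp 1)).ne'
  have hV {y : G} (hy : y ∈ E) : V q E y = (gexp q 1)⁻¹ * gexp q y := by
    rw [gexp_eq_mul_V hsupp hone hmono hy, ← mul_assoc, ENNReal.inv_mul_cancel h0 hfin.ne,
      one_mul]
  have hk : kapp q (V q E) x = (gexp q 1)⁻¹ * kapp q (gexp q) x := by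
    rw [kapp, kapp, ← ENNReal.tsum_mul_left]
    refine tsum_congr fun y => ?_
    by_cases hy : q x y = 0
    · simp [hy]
    · rw [hV (hsupp x y hy).2, mul_left_comm]
  rw [hV hx, hk, gexp_eq_add x, mul_add, mul_one, add_comm]

theorem acoef_const_mul {r : ℝ≥0∞} (hr : r ≠ ⊤) (u x y : G) :
    acoef (fun x y => r * q x y) E u x y = r * acoef q E u x y := by
  unfold acoef
  split_ifs
  · rw [ENNReal.mul_sub fun _ _ => hr]
  · rfl

theorem IncreasesTo.V_const_mul {r : ℕ → ℝ≥0∞} (hr : IncreasesTo r 1) (hr' : ∀ k, r k ≠ ⊤)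
    (x : G) : IncreasesTo (fun k => V (fun x y => r k * q x y) E x) (V q E x) := by
  have h (a : ℝ≥0∞) : IncreasesTo (fun k => r k * a) a := by
    simpa using hr.mul (.const a)
  refine .gexp (fun x y => .tsum fun z => .mul (.tsum fun n => .kiter (fun x y => h _) n 1 z) ?_) x
  simpa only [acoef_const_mul (hr' _)] using h (acoef q E x z y)

theorem increasesTo_one_sub_inv : IncreasesTo (fun k : ℕ => 1 - ((k : ℝ≥0∞) + 1)⁻¹) 1 := by
  have hmono : Monotone fun k : ℕ => 1 - ((k : ℝ≥0∞) + 1)⁻¹ := fun m n h => by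
    dsimp only
    gcongr
  refine ⟨hmono, tendsto_nhds_unique (tendsto_atTop_iSup hmono) ?_⟩
  have h : Tendsto (fun k : ℕ => ((k : ℝ≥0∞) + 1)⁻¹) atTop (nhds 0) := by
    simpa using (tendsto_add_atTop_iff_nat 1).2 ENNReal.tendsto_inv_nat_nhds_zero
  simpa using ENNReal.Tendsto.sub tendsto_const_nhds h (Or.inl ENNReal.one_ne_top)

theorem V_eq_kapp_add (hsupp : ∀ x y, q x y ≠ 0 → x ∈ E ∧ y ∈ E) (hsub : ∀ x, ∑' y, q x y ≤ 1)
    (hone : (1 : G) ∈ E)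
    (hmono : ∀ x ∈ E, ∀ y ∈ E, ∀ u ∈ E, q x y ≤ q (x * u) (y * u)) {x : G} (hx : x ∈ E) :
    V q E x = kapp q (V q E) x + (gexp q 1)⁻¹ := by
  set r : ℕ → ℝ≥0∞ := fun k => 1 - ((k : ℝ≥0∞) + 1)⁻¹
  have hr : IncreasesTo r 1 := increasesTo_one_sub_inv
  have hr1 (k : ℕ) : r k < 1 :=
    ENNReal.sub_lt_self ENNReal.one_ne_top one_ne_zero (by simp)
  have hrt (k : ℕ) : r k ≠ ⊤ := (hr1 k).ne_top
  have hq (x y : G) : IncreasesTo (fun k => r k * q x y) (q x y) := by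
    simpa using hr.mul (.const (q x y))
  have heq (k : ℕ) := V_eq_kapp_add_of_lt_top (q := fun x y => r k * q x y)
    (fun x y h => hsupp x y (right_ne_zero_of_mul h)) hone
    (fun x hx y hy u hu => mul_le_mul_right (hmono x hx y hy u hu) _)
    (gexp_lt_top (r := r k) (fun x => by
      rw [ENNReal.tsum_mul_left]
      exact mul_le_of_le_one_right' (hsub x)) (hr1 k) 1) hx
  have hV := IncreasesTo.V_const_mul (q := q) (E := E) hr hrt
  have hP : IncreasesTo (fun k => kapp (fun x y => r k * q x y) (V (fun x y => r k * q x y) E) x)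
      (kapp q (V q E) x) := .tsum fun y => (hq x y).mul (hV y)
  refine tendsto_nhds_unique (hV x).tendsto ?_
  simp only [heq]
  exact hP.tendsto.add (tendsto_inv_iff.2 (IncreasesTo.gexp hq 1).tendsto)

end Group

end RW

theorem statement12 {G : Type*} [Group G] [Countable G]
    (p : G → G → ℝ≥0∞) (E : Set G)
    (hsupp : ∀ x y, p x y ≠ 0 → x ∈ E ∧ y ∈ E)
    (hsub : ∀ x, (∑' y, p x y) ≤ 1)
    (hirr : ∀ x ∈ E, ∀ y ∈ E, 0 < hitProb p x y)
    (htrans : ∀ x ∈ E, green p x x < ⊤)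
    (hone : (1 : G) ∈ E)
    (hmul : ∀ x ∈ E, ∀ y ∈ E, x * y ∈ E)
    (hmono : ∀ x ∈ E, ∀ y ∈ E, ∀ u ∈ E, p x y ≤ p (x * u) (y * u)) :
    V p E 1 = 1 ∧
    (∀ x ∈ E, kapp p (V p E) x ≤ V p E x) ∧
    ∃ c : ℝ≥0∞, ∀ x ∈ E, V p E x - kapp p (V p E) x = c := by
  have hV := fun {x : G} (hx : x ∈ E) => V_eq_kapp_add hsupp hsub hone hmono hx
  have hle : ∀ x ∈ E, kapp p (V p E) x ≤ V p E x := fun x hx => by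
    rw [hV hx]
    exact le_self_add
  refine ⟨V_one hsupp, hle, (gexp p 1)⁻¹, fun x hx => ?_⟩
  obtain ⟨n, hn⟩ : ∃ n, fhit p n 1 x ≠ 0 := by
    by_contra! hc
    exact (hirr 1 hone x hx).ne' (ENNReal.tsum_eq_zero.2 hc)
  have hfin : V p E x < ⊤ := lt_top_of_fhit_ne_zero (fun x _ y h => (hsupp x y h).2) hle n hone
    (V_one hsupp ▸ ENNReal.one_lt_top) hn
  conv_lhs => rw [hV hx]
  exact ENNReal.add_sub_cancel_left ((hle x hx).trans_lt hfin).ne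
end
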